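/- Fix t ∈ (0,T). Let M : ℝ³ × ℝ → ℝ^{3×3} be C¹ with M(x,t) symmetric for every x ∈ ℝ³, M(x,t) N(x,t) = 0 (the zero vector) for every x ∈ Γ(t), and M(x,t) ν(x,t) = 0 for H¹-a.e. x ∈ ∂Γ(t). Then ∫_{Γ(t)} x × (div_Γ M)(x,t) dH²(x) = 0 ∈ ℝ³, where (div_Γ M)_i = Σ_j ∂_j^Γ M_{ij} and × is the cross product on ℝ³. -/

import Mathlib

noncomputable section
open MeasureTheory

/-- ℝ² with the Euclidean structure. -/
abbrev E2 : Type := EuclideanSpace ℝ (Fin 2)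
/-- ℝ³ with the Euclidean structure. -/
abbrev E3 : Type := EuclideanSpace ℝ (Fin 3)

/-- The cross product on ℝ³. -/
def cross3 (a b : E3) : E3 :=
  (EuclideanSpace.equiv (Fin 3) ℝ).symm
    ![a 1 * b 2 - a 2 * b 1, a 2 * b 0 - a 0 * b 2, a 0 * b 1 - a 1 * b 0]

/-- The dot product on ℝ³. -/
def dot3 (a b : E3) : ℝ := ∑ i, a i * b i

/-- The tangent vector `g_α = ∂x̂/∂X_α` of the parametrization `x̂` at `(X, t)`. -/
def gVec (xh : E2 × ℝ → E3) (α : Fin 2) (X : E2) (t : ℝ) : E3 :=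
  fderiv ℝ (fun Y : E2 => xh (Y, t)) X (EuclideanSpace.single α 1)

/-- The Riemannian metric `g_{αβ} = g_α · g_β`. -/
def gMet (xh : E2 × ℝ → E3) (α β : Fin 2) (X : E2) (t : ℝ) : ℝ :=
  dot3 (gVec xh α X t) (gVec xh β X t)

/-- The Gram determinant `G = g₁₁ g₂₂ − g₁₂ g₂₁`. -/
def Gdet (xh : E2 × ℝ → E3) (X : E2) (t : ℝ) : ℝ :=
  gMet xh 0 0 X t * gMet xh 1 1 X t - gMet xh 0 1 X t * gMet xh 1 0 X t

/-- The inverse metric `(g^{αβ}) = (g_{αβ})⁻¹`. -/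
def gInv (xh : E2 × ℝ → E3) (X : E2) (t : ℝ) : Matrix (Fin 2) (Fin 2) ℝ :=
  (Matrix.of fun α β => gMet xh α β X t)⁻¹

/-- The raised tangent vector `g^α = Σ_β g^{αβ} g_β`. -/
def gVecUp (xh : E2 × ℝ → E3) (α : Fin 2) (X : E2) (t : ℝ) : E3 :=
  ∑ β, gInv xh X t α β • gVec xh β X t

/-- The unit normal `n̂ = (g₁ × g₂)/|g₁ × g₂|` of the parametrized surface. -/
def nHat (xh : E2 × ℝ → E3) (X : E2) (t : ℝ) : E3 :=
  ‖cross3 (gVec xh 0 X t) (gVec xh 1 X t)‖⁻¹ • cross3 (gVec xh 0 X t) (gVec xh 1 X t)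

/-- Spatial partial derivative `∂f/∂x_j` at `(x, t)`. -/
def pdx (j : Fin 3) (f : E3 × ℝ → ℝ) (x : E3) (t : ℝ) : ℝ :=
  fderiv ℝ (fun y : E3 => f (y, t)) x (EuclideanSpace.single j 1)

/-- Time partial derivative `∂f/∂t` at `(x, t)`. -/
def pdt (f : E3 × ℝ → ℝ) (x : E3) (t : ℝ) : ℝ := deriv (fun s => f (x, s)) t

/-- Tangential derivative `∂_j^Γ f = Σ_i (δ_{ij} − N_i N_j) ∂f/∂x_i`
with normal extension `N`. -/
def tder (N : E3 × ℝ → E3) (j : Fin 3) (f : E3 × ℝ → ℝ) (x : E3) (t : ℝ) : ℝ :=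
  ∑ i, ((if i = j then (1 : ℝ) else 0) - N (x, t) i * N (x, t) j) * pdx i f x t

/-- Surface gradient `grad_Γ f = (∂_1^Γ f, ∂_2^Γ f, ∂_3^Γ f)`. -/
def sgrad (N : E3 × ℝ → E3) (f : E3 × ℝ → ℝ) (x : E3) (t : ℝ) : E3 :=
  (EuclideanSpace.equiv (Fin 3) ℝ).symm fun j => tder N j f x t

/-- Surface divergence `div_Γ φ = Σ_j ∂_j^Γ φ_j`. -/
def sdiv (N : E3 × ℝ → E3) (φ : E3 × ℝ → E3) (x : E3) (t : ℝ) : ℝ :=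
  ∑ j, tder N j (fun p => φ p j) x t

/-- Row-wise surface divergence of a matrix field: `(div_Γ M)_i = Σ_j ∂_j^Γ M_{ij}`. -/
def sdivM (N : E3 × ℝ → E3) (M : E3 × ℝ → Matrix (Fin 3) (Fin 3) ℝ) (x : E3) (t : ℝ) : E3 :=
  (EuclideanSpace.equiv (Fin 3) ℝ).symm fun i => ∑ j, tder N j (fun p => M p i j) x t

/-- The orthogonal projection matrix `P_Γ = I − N ⊗ N`. -/
def Pmat (N : E3 × ℝ → E3) (x : E3) (t : ℝ) : Matrix (Fin 3) (Fin 3) ℝ :=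
  Matrix.of fun i j => (if i = j then (1 : ℝ) else 0) - N (x, t) i * N (x, t) j

/-- The symmetric gradient `D(φ) = ((∇φ) + (∇φ)ᵀ)/2`. -/
def Dmat (φ : E3 × ℝ → E3) (x : E3) (t : ℝ) : Matrix (Fin 3) (Fin 3) ℝ :=
  Matrix.of fun i j => (pdx i (fun p => φ p j) x t + pdx j (fun p => φ p i) x t) / 2

/-- The surface stretching tensor `D_Γ(φ) = P_Γ D(φ) P_Γ`. -/
def DGam (N : E3 × ℝ → E3) (φ : E3 × ℝ → E3) (x : E3) (t : ℝ) : Matrix (Fin 3) (Fin 3) ℝ :=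
  Pmat N x t * Dmat φ x t * Pmat N x t

/-- The squared Frobenius norm `|M|² = Σ_{i,j} M_{ij}²`. -/
def frob2 (M : Matrix (Fin 3) (Fin 3) ℝ) : ℝ := ∑ i, ∑ j, (M i j) ^ 2

/-- The material derivative `D_t f = ∂_t f + (v · ∇)f`. -/
def Dt (v : E3 × ℝ → E3) (f : E3 × ℝ → ℝ) (x : E3) (t : ℝ) : ℝ :=
  pdt f x t + ∑ i, v (x, t) i * pdx i f x t

/-- Matrix-vector product on ℝ³. -/
def mulVec3 (M : Matrix (Fin 3) (Fin 3) ℝ) (w : E3) : E3 :=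
  (EuclideanSpace.equiv (Fin 3) ℝ).symm (M.mulVec fun i => w i)

/-- The dot product on ℝ². -/
def dot2 (a b : E2) : ℝ := ∑ i, a i * b i

/-- The unit outer co-normal
`ν = ((n₁^U g₂ − n₂^U g₁)/|n₁^U g₂ − n₂^U g₁|) × n̂` at the boundary point `x̂(X,t)`,
where `n^U` is the unit outer normal of `U ⊆ ℝ²`. -/
def conormal (xh : E2 × ℝ → E3) (nU : E2 → E2) (X : E2) (t : ℝ) : E3 :=
  cross3 (‖nU X 0 • gVec xh 1 X t - nU X 1 • gVec xh 0 X t‖⁻¹ •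
      (nU X 0 • gVec xh 1 X t - nU X 1 • gVec xh 0 X t)) (nHat xh X t)

/-- `nU` is (H¹-a.e. on `∂U`) the unit outer normal of the bounded domain `U`:
it has unit length and satisfies the Gauss–Green formula on `U`. -/
def IsUnitOuterNormal (U : Set E2) (nU : E2 → E2) : Prop :=
  (∀ᵐ X ∂((μH[1] : Measure E2).restrict (frontier U)), ‖nU X‖ = 1) ∧
  ∀ ψ : E2 → E2, ContDiff ℝ 1 ψ →
    (∫ X in U, ∑ α : Fin 2, fderiv ℝ (fun Y : E2 => ψ Y α) X (EuclideanSpace.single α 1))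
      = ∫ X in frontier U, dot2 (ψ X) (nU X) ∂(μH[1] : Measure E2)


open scoped ENNReal NNReal Topology

/-- The Gram determinant of the images of the two coordinate vectors under a linear map. -/
def gramDet {F : Type*} [NormedAddCommGroup F] [InnerProductSpace ℝ F] (L : E2 →L[ℝ] F) : ℝ :=
  inner ℝ (L (EuclideanSpace.single 0 1)) (L (EuclideanSpace.single 0 1)) *
    inner ℝ (L (EuclideanSpace.single 1 1)) (L (EuclideanSpace.single 1 1)) -
    inner ℝ (L (EuclideanSpace.single 0 1)) (L (EuclideanSpace.single 1 1)) ^ 2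

/-- Cholesky factorization of the first fundamental form: a linear map from the plane with positive
Gram determinant has the same norms as a linear automorphism of the plane. -/
theorem exists_equiv_norm_eq_of_gramDet_pos {F : Type*} [NormedAddCommGroup F]
    [InnerProductSpace ℝ F] (L : E2 →L[ℝ] F) (hL : 0 < gramDet L) :
    ∃ S : E2 ≃L[ℝ] E2, (∀ v, ‖S v‖ = ‖L v‖) ∧
      |LinearMap.det ((S : E2 →L[ℝ] E2) : E2 →ₗ[ℝ] E2)| = √(gramDet L) := by
  set a := L (EuclideanSpace.single 0 1) with ha
  set b := L (EuclideanSpace.single 1 1) with hb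
  have hgram : gramDet L = ‖a‖ ^ 2 * ‖b‖ ^ 2 - inner ℝ a b ^ 2 := by
    simp [gramDet, ← ha, ← hb]
  have ha0 : 0 < ‖a‖ := by
    refine norm_pos_iff.2 fun h => ?_
    rw [hgram, h] at hL
    simp at hL
  set q := inner ℝ a b / ‖a‖ with hq
  set r := √(gramDet L) / ‖a‖ with hr
  have hr2 : r ^ 2 = ‖b‖ ^ 2 - q ^ 2 := by
    rw [hr, hq, div_pow, Real.sq_sqrt hL.le, hgram]
    field_simp
  have hLv (v : E2) : L v = v 0 • a + v 1 • b := by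
    have : v = v 0 • EuclideanSpace.single 0 1 + v 1 • EuclideanSpace.single 1 1 := by
      ext i; fin_cases i <;> simp
    conv_lhs => rw [this]
    simp [ha, hb]
  let A : E2 →ₗ[ℝ] E2 := Matrix.toLin (EuclideanSpace.basisFun (Fin 2) ℝ).toBasis
    (EuclideanSpace.basisFun (Fin 2) ℝ).toBasis !![‖a‖, q; 0, r]
  have hdet : LinearMap.det A = √(gramDet L) := by
    simp only [A, LinearMap.det_toLin, Matrix.det_fin_two_of, hr]
    field_simp
    simp
  have hAv (v : E2) : ‖A v‖ = ‖L v‖ := by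
    have h0 : A v 0 = ‖a‖ * v 0 + q * v 1 := by
      simp [A, Matrix.toLin_apply, Matrix.mulVec, dotProduct, Fin.sum_univ_two]
    have h1 : A v 1 = r * v 1 := by
      simp [A, Matrix.toLin_apply, Matrix.mulVec, dotProduct, Fin.sum_univ_two]
    rw [← sq_eq_sq₀ (norm_nonneg _) (norm_nonneg _), EuclideanSpace.norm_sq_eq, hLv,
      norm_add_sq_real, norm_smul, norm_smul, inner_smul_left, inner_smul_right]
    simp only [Fin.sum_univ_two, Real.norm_eq_abs, sq_abs, h0, h1, mul_pow, hr2]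
    have : inner ℝ a b = ‖a‖ * q := by rw [hq]; field_simp
    simp only [this, conj_trivial]
    ring
  have hu : IsUnit (LinearMap.det A) := by
    rw [hdet]; exact (Real.sqrt_pos.2 hL).ne'.isUnit
  refine ⟨(LinearMap.equivOfDetNeZero A hu.ne_zero).toContinuousLinearEquiv, fun v => hAv v, ?_⟩
  change |LinearMap.det A| = _
  rw [hdet, abs_of_nonneg (Real.sqrt_nonneg _)]

/-- Hausdorff measure is controlled by comparing distances along two parametrizations. -/
theorem hausdorffMeasure_image_le_of_edist_le {α X Y : Type*} [EMetricSpace X] [EMetricSpace Y]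
    [MeasurableSpace X] [BorelSpace X] [MeasurableSpace Y] [BorelSpace Y]
    {u : α → X} {v : α → Y} {A : Set α} {K : ℝ≥0} {d : ℝ} (hd : 0 ≤ d)
    (h : ∀ x ∈ A, ∀ y ∈ A, edist (u x) (u y) ≤ K * edist (v x) (v y)) :
    (μH[d] : Measure X) (u '' A) ≤ (K : ℝ≥0∞) ^ d * (μH[d] : Measure Y) (v '' A) := by
  rcases isEmpty_or_nonempty α with hα | hα
  · simp [Set.eq_empty_of_isEmpty A]
  have hinv : ∀ x ∈ A, Function.invFunOn v A (v x) ∈ A ∧ v (Function.invFunOn v A (v x)) = v x :=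
    fun x hx => ⟨Function.invFunOn_apply_mem hx, Function.invFunOn_apply_eq hx⟩
  have himg : u '' A = (u ∘ Function.invFunOn v A) '' (v '' A) := by
    rw [Set.image_image]
    refine Set.image_congr fun x hx => ?_
    have := h x hx _ (hinv x hx).1
    rw [(hinv x hx).2, edist_self, mul_zero] at this
    exact edist_le_zero.1 this
  rw [himg]
  refine LipschitzOnWith.hausdorffMeasure_image_le ?_ hd
  rintro _ ⟨x, hx, rfl⟩ _ ⟨y, hy, rfl⟩
  have := h _ (hinv x hx).1 _ (hinv y hy).1
  rwa [(hinv x hx).2, (hinv y hy).2] at this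

/-- A measure is dominated by another one as soon as it is so locally. -/
theorem measure_le_of_locally_le {α : Type*} [TopologicalSpace α] [SecondCountableTopology α]
    [MeasurableSpace α] [OpensMeasurableSpace α] {ρ ν : Measure α}
    (h : ∀ x, ∃ V, IsOpen V ∧ x ∈ V ∧ ∀ A ⊆ V, MeasurableSet A → ρ A ≤ ν A) : ρ ≤ ν := by
  choose V hVo hxV hV using h
  rcases isEmpty_or_nonempty α with hα | hα
  · intro s; simp [Set.eq_empty_of_isEmpty s]
  obtain ⟨T, hTc, hT⟩ := TopologicalSpace.countable_cover_nhds
    fun x => (hVo x).mem_nhds (hxV x)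
  have hTne : T.Nonempty := by
    by_contra hne
    rw [Set.not_nonempty_iff_eq_empty] at hne
    simp only [hne, Set.mem_empty_iff_false, Set.iUnion_of_empty, Set.iUnion_empty] at hT
    exact Set.empty_ne_univ hT
  obtain ⟨x, rfl⟩ := hTc.exists_eq_range hTne
  rw [Set.biUnion_range] at hT
  refine Measure.le_iff.2 fun A hA => ?_
  have hm : ∀ n, MeasurableSet (disjointed (fun n => V (x n)) n) :=
    MeasurableSet.disjointed fun n => (hVo _).measurableSet
  have hAU : A = ⋃ n, A ∩ disjointed (fun n => V (x n)) n := by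
    rw [← Set.inter_iUnion, iUnion_disjointed, hT, Set.inter_univ]
  have hdisj : Pairwise (Function.onFun Disjoint fun n => A ∩ disjointed (fun n => V (x n)) n) :=
    fun i j hij => ((disjoint_disjointed _) hij).mono Set.inter_subset_right Set.inter_subset_right
  rw [hAU, measure_iUnion hdisj fun n => hA.inter (hm n),
    measure_iUnion hdisj fun n => hA.inter (hm n)]
  exact ENNReal.tsum_le_tsum fun n => hV (x n) _
    (Set.inter_subset_right.trans (disjointed_subset _ _)) (hA.inter (hm n))

instance : (μH[2] : Measure E2).IsAddHaarMeasure := by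
  simpa using MeasureTheory.isAddHaarMeasure_hausdorffMeasure (E := E2)

/-- Near a point where a map from the plane is an immersion, its distances are close to those of a
linear automorphism of the plane. -/
theorem exists_open_edist_le {f : E2 → E3} (hf : ContDiff ℝ 1 f) {X₀ : E2} {S : E2 ≃L[ℝ] E2}
    (hS : ∀ v, ‖S v‖ = ‖fderiv ℝ f X₀ v‖) {c : ℝ≥0} (hc : 1 < c) :
    ∃ V, IsOpen V ∧ X₀ ∈ V ∧ ∀ x ∈ V, ∀ y ∈ V,
      edist (f x) (f y) ≤ c * edist (S x) (S y) ∧ edist (S x) (S y) ≤ c * edist (f x) (f y) := by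
  have hc0 : (0 : ℝ) < c := by exact_mod_cast zero_lt_one.trans hc
  have hc1 : (1 : ℝ) < c := by exact_mod_cast hc
  set K := ‖(S.symm : E2 →L[ℝ] E2)‖ with hK
  have hK0 : 0 ≤ K := norm_nonneg _
  set ε := 1 - (c : ℝ)⁻¹ with hε
  have hε0 : 0 < ε := by rw [hε]; have := inv_lt_one_of_one_lt₀ hc1; linarith
  have hεc : ε ≤ c - 1 := by
    have h : (c : ℝ) * (c : ℝ)⁻¹ = 1 := mul_inv_cancel₀ hc0.ne'
    rw [hε]
    nlinarith [inv_pos.2 hc0, mul_pos (sub_pos.2 hc1) (sub_pos.2 (inv_lt_one_of_one_lt₀ hc1))]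
  have hδ : 0 < ε / (K + 1) := by positivity
  have hstrict : HasStrictFDerivAt f (fderiv ℝ f X₀) X₀ :=
    hf.contDiffAt.hasStrictFDerivAt (by norm_num)
  have hev := hstrict.isLittleO.bound hδ
  rw [nhds_prod_eq, Filter.eventually_prod_self_iff'] at hev
  obtain ⟨W, hW, hWle⟩ := hev
  obtain ⟨V, hVW, hVo, hXV⟩ := mem_nhds_iff.1 hW
  refine ⟨V, hVo, hXV, fun x hx y hy => ?_⟩
  have hxy : ‖f x - f y - fderiv ℝ f X₀ (x - y)‖ ≤ ε * ‖S (x - y)‖ := by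
    refine (hWle x (hVW hx) y (hVW hy)).trans ?_
    have hle : ‖x - y‖ ≤ K * ‖S (x - y)‖ := by
      simpa using (S.symm : E2 →L[ℝ] E2).le_opNorm (S (x - y))
    calc ε / (K + 1) * ‖x - y‖ ≤ ε / (K + 1) * ((K + 1) * ‖S (x - y)‖) := by
          gcongr; nlinarith [norm_nonneg (S (x - y))]
      _ = ε * ‖S (x - y)‖ := by field_simp
  have hup : ‖f x - f y‖ ≤ c * ‖S (x - y)‖ := by
    have := norm_le_norm_add_norm_sub' (f x - f y) (fderiv ℝ f X₀ (x - y))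
    rw [← hS] at this
    nlinarith [norm_nonneg (S (x - y))]
  have hlow : ‖S (x - y)‖ ≤ c * ‖f x - f y‖ := by
    have := norm_le_norm_add_norm_sub (f x - f y) (fderiv ℝ f X₀ (x - y))
    rw [← hS] at this
    have h : (c : ℝ)⁻¹ * ‖S (x - y)‖ ≤ ‖f x - f y‖ := by
      rw [hε] at hxy
      linarith
    rwa [inv_mul_le_iff₀ hc0] at h
  rw [map_sub] at hup hlow
  simp only [edist_dist, dist_eq_norm, ← ENNReal.ofReal_coe_nnreal,
    ← ENNReal.ofReal_mul (NNReal.coe_nonneg c)]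
  exact ⟨ENNReal.ofReal_le_ofReal hup, ENNReal.ofReal_le_ofReal hlow⟩

theorem continuous_gramDet_fderiv {f : E2 → E3} (hf : ContDiff ℝ 1 f) :
    Continuous fun X => gramDet (fderiv ℝ f X) := by
  have := hf.continuous_fderiv (by norm_num)
  unfold gramDet
  fun_prop

/-- Near a point where a map from the plane is an immersion, the area formula holds up to a factor
arbitrarily close to one. -/
theorem exists_open_hausdorffMeasure_image_le {f : E2 → E3} (hf : ContDiff ℝ 1 f) {X₀ : E2}
    (hX₀ : 0 < gramDet (fderiv ℝ f X₀)) {c : ℝ≥0} (hc : 1 < c) :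
    ∃ V, IsOpen V ∧ X₀ ∈ V ∧ ∀ A ⊆ V, MeasurableSet A →
      μH[2] (f '' A) ≤ c ^ 3 * ∫⁻ X in A, ENNReal.ofReal √(gramDet (fderiv ℝ f X)) ∂μH[2] ∧
      ∫⁻ X in A, ENNReal.ofReal √(gramDet (fderiv ℝ f X)) ∂μH[2] ≤ c ^ 3 * μH[2] (f '' A) := by
  obtain ⟨S, hS, hdet⟩ := exists_equiv_norm_eq_of_gramDet_pos _ hX₀
  obtain ⟨V, hVo, hXV, hV⟩ := exists_open_edist_le hf hS hc
  set J : E2 → ℝ := fun X => √(gramDet (fderiv ℝ f X)) with hJ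
  have hJc : Continuous J := (continuous_gramDet_fderiv hf).sqrt
  have hJ0 : 0 < J X₀ := Real.sqrt_pos.2 hX₀
  have hc1 : (1 : ℝ) < c := by exact_mod_cast hc
  have hc0 : (0 : ℝ) < c := zero_lt_one.trans hc1
  set W : Set E2 := {X | J X < c * J X₀} ∩ {X | J X₀ < c * J X} with hW
  have hWo : IsOpen W := (isOpen_lt hJc continuous_const).inter
    (isOpen_lt continuous_const (continuous_const.mul hJc))
  have hXW : X₀ ∈ W := ⟨by change J X₀ < c * J X₀; nlinarith, by change J X₀ < c * J X₀; nlinarith⟩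
  refine ⟨V ∩ W, hVo.inter hWo, ⟨hXV, hXW⟩, fun A hA hAm => ?_⟩
  have hSA : (μH[2] : Measure E2) (S '' A) = ENNReal.ofReal (J X₀) * μH[2] A := by
    rw [show J X₀ = _ from hdet.symm]
    exact Measure.addHaar_image_continuousLinearMap _ (S : E2 →L[ℝ] E2) A
  have hfS : (μH[2] : Measure E3) (f '' A) ≤ c ^ 2 * μH[2] (S '' A) := by
    simpa using hausdorffMeasure_image_le_of_edist_le (d := 2) zero_le_two
      fun x hx y hy => (hV x (hA hx).1 y (hA hy).1).1
  have hSf : (μH[2] : Measure E2) (S '' A) ≤ c ^ 2 * μH[2] (f '' A) := by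
    simpa using hausdorffMeasure_image_le_of_edist_le (d := 2) zero_le_two
      fun x hx y hy => (hV x (hA hx).1 y (hA hy).1).2
  have hcJ (x : ℝ) : (c : ℝ≥0∞) * ENNReal.ofReal x = ENNReal.ofReal (c * x) := by
    rw [ENNReal.ofReal_mul hc0.le, ENNReal.ofReal_coe_nnreal]
  have hJm : Measurable fun X => ENNReal.ofReal (J X) := hJc.measurable.ennreal_ofReal
  have hlow : ENNReal.ofReal (J X₀) * μH[2] A ≤ c * ∫⁻ X in A, ENNReal.ofReal (J X) ∂μH[2] := by
    rw [← lintegral_const_mul _ hJm, ← setLIntegral_const]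
    refine setLIntegral_mono' hAm fun X hX => ?_
    rw [hcJ]
    exact ENNReal.ofReal_le_ofReal (hA hX).2.2.le
  have hup : ∫⁻ X in A, ENNReal.ofReal (J X) ∂μH[2] ≤ c * (ENNReal.ofReal (J X₀) * μH[2] A) := by
    rw [← mul_assoc, ← setLIntegral_const]
    refine setLIntegral_mono' hAm fun X hX => ?_
    rw [hcJ]
    exact ENNReal.ofReal_le_ofReal (hA hX).2.1.le
  constructor
  · calc (μH[2] : Measure E3) (f '' A) ≤ c ^ 2 * μH[2] (S '' A) := hfS
      _ ≤ c ^ 2 * (c * ∫⁻ X in A, ENNReal.ofReal (J X) ∂μH[2]) := by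
          rw [hSA]; gcongr
      _ = c ^ 3 * ∫⁻ X in A, ENNReal.ofReal (J X) ∂μH[2] := by ring
  · calc ∫⁻ X in A, ENNReal.ofReal (J X) ∂μH[2] ≤ c * μH[2] (S '' A) := by rwa [hSA]
      _ ≤ c * (c ^ 2 * μH[2] (f '' A)) := by gcongr
      _ = c ^ 3 * μH[2] (f '' A) := by ring

/-- The area formula for an injective immersion of a plane domain, as an equality of measures. -/
theorem map_withDensity_sqrt_gramDet {f : E2 → E3} (hf : ContDiff ℝ 1 f) {U : Set E2}
    (hU : IsOpen U) (hinj : Set.InjOn f U) (hG : ∀ X ∈ U, 0 < gramDet (fderiv ℝ f X)) :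
    Measure.map f (((μH[2] : Measure E2).restrict U).withDensity
      fun X => ENNReal.ofReal √(gramDet (fderiv ℝ f X))) =
      (μH[2] : Measure E3).restrict (f '' U) := by
  set ν : Measure U := Measure.comap (↑) ((μH[2] : Measure E2).withDensity
      fun X => ENNReal.ofReal √(gramDet (fderiv ℝ f X))) with hν
  have hemb : MeasurableEmbedding (U.domRestrict f) :=
    hf.continuous.continuousOn.measurableEmbedding hU.measurableSet hinj
  set ρ : Measure U := Measure.comap (U.domRestrict f) (μH[2] : Measure E3) with hρ
  have hsub := MeasurableEmbedding.subtype_coe hU.measurableSet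
  have hνA (A : Set U) (hA : MeasurableSet A) : ν A = ∫⁻ X in (↑) '' A,
      ENNReal.ofReal √(gramDet (fderiv ℝ f X)) ∂μH[2] := by
    rw [hν, hsub.comap_apply, withDensity_apply _ (hsub.measurableSet_image' hA)]
  have hρA (A : Set U) : ρ A = μH[2] (f '' ((↑) '' A)) := by
    rw [hρ, hemb.comap_apply, Set.image_image]; rfl
  have key (c : ℝ≥0) (hc : 1 < c) : ρ ≤ (c ^ 3) • ν ∧ ν ≤ (c ^ 3) • ρ := by
    constructor <;>
    · refine measure_le_of_locally_le fun X => ?_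
      obtain ⟨V, hVo, hXV, hV⟩ := exists_open_hausdorffMeasure_image_le hf (hG X X.2) hc
      refine ⟨Subtype.val ⁻¹' V, hVo.preimage continuous_subtype_val, hXV, fun A hA hAm => ?_⟩
      have := hV ((↑) '' A) (Set.image_subset_iff.2 hA) (hsub.measurableSet_image' hAm)
      rw [← hνA A hAm, ← hρA] at this
      simp only [Measure.smul_apply, ENNReal.smul_def, smul_eq_mul, ENNReal.coe_pow]
      first | exact this.1 | exact this.2
  have hρν : ρ = ν := by
    have hlim (a : ℝ≥0∞) : Filter.Tendsto (fun c : ℝ≥0 => ((c : ℝ≥0∞) ^ 3) * a) (𝓝[>] 1)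
        (𝓝 a) := by
      have h : Filter.Tendsto (fun c : ℝ≥0 => ((c ^ 3 : ℝ≥0) : ℝ≥0∞)) (𝓝[>] 1)
          (𝓝 ((1 ^ 3 : ℝ≥0) : ℝ≥0∞)) :=
        (ENNReal.continuous_coe.comp (continuous_pow 3)).continuousWithinAt
      simpa using ENNReal.Tendsto.mul_const (b := a) h (Or.inl (by simp))
    refine le_antisymm (Measure.le_iff'.2 fun A => ?_) (Measure.le_iff'.2 fun A => ?_)
    · refine ge_of_tendsto (hlim _) (eventually_mem_nhdsWithin.mono fun c hc => ?_)
      simpa [ENNReal.smul_def] using Measure.le_iff'.1 (key c hc).1 A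
    · refine ge_of_tendsto (hlim _) (eventually_mem_nhdsWithin.mono fun c hc => ?_)
      simpa [ENNReal.smul_def] using Measure.le_iff'.1 (key c hc).2 A
  have h1 : Measure.map (U.domRestrict f) ρ = (μH[2] : Measure E3).restrict (f '' U) := by
    rw [hρ, hemb.map_comap, Set.range_domRestrict]
  rw [← h1, hρν, ← restrict_withDensity hU.measurableSet, ← map_comap_subtype_coe hU.measurableSet,
    Measure.map_map hf.continuous.measurable measurable_subtype_coe]
  rfl

/-- Change of variables in a surface integral over an injectively parametrized surface. -/
theorem setIntegral_image_eq_setIntegral_sqrt_gramDet_smul {F : Type*} [NormedAddCommGroup F]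
    [NormedSpace ℝ F] {f : E2 → E3} (hf : ContDiff ℝ 1 f) {U : Set E2}
    (hU : IsOpen U) (hinj : Set.InjOn f U) (hG : ∀ X ∈ U, 0 < gramDet (fderiv ℝ f X))
    {h : E3 → F} (hh : Continuous h) :
    ∫ x in f '' U, h x ∂μH[2] = ∫ X in U, √(gramDet (fderiv ℝ f X)) • h (f X) ∂μH[2] := by
  rw [← map_withDensity_sqrt_gramDet hf hU hinj hG,
    integral_map hf.continuous.aemeasurable hh.aestronglyMeasurable,
    integral_withDensity_eq_integral_toReal_smul]
  · simp [ENNReal.toReal_ofReal]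
  · exact (continuous_gramDet_fderiv hf).sqrt.measurable.ennreal_ofReal
  · simp

@[simp] theorem cross3_zero (a b : E3) : cross3 a b 0 = a 1 * b 2 - a 2 * b 1 := rfl
@[simp] theorem cross3_one (a b : E3) : cross3 a b 1 = a 2 * b 0 - a 0 * b 2 := rfl
@[simp] theorem cross3_two (a b : E3) : cross3 a b 2 = a 0 * b 1 - a 1 * b 0 := rfl

theorem dot3_eq (a b : E3) : dot3 a b = a 0 * b 0 + a 1 * b 1 + a 2 * b 2 := by
  simp [dot3, Fin.sum_univ_three]

theorem norm_sq_eq_dot3 (a : E3) : ‖a‖ ^ 2 = dot3 a a := by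
  simp [EuclideanSpace.norm_sq_eq, dot3, ← pow_two]

/-- Lagrange's identity. -/
theorem norm_cross3 (a b : E3) :
    ‖cross3 a b‖ = √(dot3 a a * dot3 b b - dot3 a b * dot3 b a) := by
  rw [← Real.sqrt_sq (norm_nonneg (cross3 a b)), norm_sq_eq_dot3]
  simp only [dot3_eq, cross3_zero, cross3_one, cross3_two]
  ring_nf

/-- Three vectors orthogonal to the same unit vector are linearly dependent. -/
theorem dot3_cross3_eq_zero_of_orthogonal {u v w n : E3} (hn : dot3 n n = 1) (hu : dot3 u n = 0)
    (hv : dot3 v n = 0) (hw : dot3 w n = 0) : dot3 u (cross3 v w) = 0 := by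
  have h (i : Fin 3) : dot3 u (cross3 v w) * n i = 0 := by
    have : dot3 u (cross3 v w) * n i = cross3 v w i * dot3 u n + cross3 w u i * dot3 v n
        + cross3 u v i * dot3 w n := by
      fin_cases i <;> simp [dot3_eq] <;> ring
    rw [this, hu, hv, hw]; ring
  rw [dot3_eq] at hn
  linear_combination n 0 * h 0 + n 1 * h 1 + n 2 * h 2 - dot3 u (cross3 v w) * hn

/-- Resolution of the identity along a basis whose third vector is a unit normal. -/
theorem mul_cross3_add_mul_cross3 {a b n : E3} {J : ℝ} (hn : dot3 n n = 1)
    (hab : cross3 a b = J • n) (i j : Fin 3) :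
    a i * cross3 b n j + b i * cross3 n a j = J * ((if i = j then 1 else 0) - n i * n j) := by
  have h (k : Fin 3) : cross3 a b k = J * n k := by rw [hab]; simp
  have h0 := h 0
  have h1 := h 1
  have h2 := h 2
  simp only [cross3_zero, cross3_one, cross3_two] at h0 h1 h2
  rw [dot3_eq] at hn
  fin_cases i <;> fin_cases j <;> simp
  · linear_combination n 1 * h1 + n 2 * h2 + J * hn
  · linear_combination - n 0 * h1
  · linear_combination - n 0 * h2
  · linear_combination - n 1 * h0
  · linear_combination n 0 * h0 + n 2 * h2 + J * hn
  · linear_combination - n 1 * h2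
  · linear_combination - n 2 * h0
  · linear_combination - n 2 * h1
  · linear_combination n 1 * h1 + n 0 * h0 + J * hn

theorem gramDet_fderiv_eq_Gdet (xh : E2 × ℝ → E3) (X : E2) (t : ℝ) :
    gramDet (fderiv ℝ (fun Y : E2 => xh (Y, t)) X) = Gdet xh X t := by
  simp only [gramDet, Gdet, gMet, gVec, dot3, PiLp.inner_apply, RCLike.inner_apply, conj_trivial,
    Fin.sum_univ_three]
  ring

theorem cross3_gVec_eq (xh : E2 × ℝ → E3) {X : E2} {t : ℝ} (hG : 0 < Gdet xh X t) :
    cross3 (gVec xh 0 X t) (gVec xh 1 X t) = √(Gdet xh X t) • nHat xh X t := by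
  have h : ‖cross3 (gVec xh 0 X t) (gVec xh 1 X t)‖ = √(Gdet xh X t) := norm_cross3 _ _
  rw [nHat, h, smul_inv_smul₀ (Real.sqrt_pos.2 hG).ne']

theorem contDiff_slice {F : Type*} [NormedAddCommGroup F] [NormedSpace ℝ F] {E : Type*}
    [NormedAddCommGroup E] [NormedSpace ℝ E] {n : WithTop ℕ∞}
    {f : E × ℝ → F} (hf : ContDiff ℝ n f) (t : ℝ) : ContDiff ℝ n fun y => f (y, t) :=
  hf.comp (contDiff_id.prodMk contDiff_const)

theorem contDiff_gVec {xh : E2 × ℝ → E3} {t : ℝ} (hxh : ContDiff ℝ 2 xh) (α : Fin 2) :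
    ContDiff ℝ 1 fun X => gVec xh α X t :=
  ((contDiff_slice hxh t).fderiv_right (m := 1) (by norm_num)).clm_apply contDiff_const

/-- Mixed second derivatives of the parametrization commute. -/
theorem fderiv_gVec_comm {xh : E2 × ℝ → E3} {t : ℝ} (hxh : ContDiff ℝ 2 xh) (X : E2) :
    fderiv ℝ (fun Y => gVec xh 1 Y t) X (EuclideanSpace.single 0 1) =
      fderiv ℝ (fun Y => gVec xh 0 Y t) X (EuclideanSpace.single 1 1) := by
  have hf := contDiff_slice hxh t
  have hsymm : IsSymmSndFDerivAt ℝ (fun Y : E2 => xh (Y, t)) X :=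
    hf.contDiffAt.isSymmSndFDerivAt (by simp)
  have hd : DifferentiableAt ℝ (fderiv ℝ fun Y : E2 => xh (Y, t)) X :=
    (hf.fderiv_right (m := 1) (by norm_num)).differentiable (by norm_num) X
  have hform (α : Fin 2) (v : E2) : fderiv ℝ (fun Y => gVec xh α Y t) X v =
      fderiv ℝ (fderiv ℝ fun Y : E2 => xh (Y, t)) X v (EuclideanSpace.single α 1) := by
    have h : HasFDerivAt (fun Y => gVec xh α Y t) _ X :=
      hd.hasFDerivAt.clm_apply (hasFDerivAt_const (EuclideanSpace.single α (1 : ℝ)) X)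
    rw [h.fderiv]
    simp
  rw [hform, hform, hsymm]

theorem fderiv_dot3_cross3 {u v w : E2 → E3} {X : E2} (hu : DifferentiableAt ℝ u X)
    (hv : DifferentiableAt ℝ v X) (hw : DifferentiableAt ℝ w X) (e : E2) :
    fderiv ℝ (fun Y => dot3 (u Y) (cross3 (v Y) (w Y))) X e =
      dot3 (fderiv ℝ u X e) (cross3 (v X) (w X)) + dot3 (u X) (cross3 (fderiv ℝ v X e) (w X)) +
        dot3 (u X) (cross3 (v X) (fderiv ℝ w X e)) := by
  have hc {z : E2 → E3} (hz : DifferentiableAt ℝ z X) (j : Fin 3) :=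
    ((EuclideanSpace.proj j : E3 →L[ℝ] ℝ).hasFDerivAt).comp X hz.hasFDerivAt
  have h := (((hc hu 0).mul (((hc hv 1).mul (hc hw 2)).sub ((hc hv 2).mul (hc hw 1)))).add
    ((hc hu 1).mul (((hc hv 2).mul (hc hw 0)).sub ((hc hv 0).mul (hc hw 2))))).add
    ((hc hu 2).mul (((hc hv 0).mul (hc hw 1)).sub ((hc hv 1).mul (hc hw 0))))
  rw [HasFDerivAt.fderiv (h.congr_of_eventuallyEq (Filter.Eventually.of_forall fun Y => ?_))]
  · simp [dot3_eq]
    ring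
  · simp [dot3_eq]

theorem contDiff_dot3_cross3 {u v w : E2 → E3} (hu : ContDiff ℝ 1 u) (hv : ContDiff ℝ 1 v)
    (hw : ContDiff ℝ 1 w) : ContDiff ℝ 1 fun Y => dot3 (u Y) (cross3 (v Y) (w Y)) := by
  rw [contDiff_euclidean] at hu hv hw
  simp only [dot3_eq, cross3_zero, cross3_one, cross3_two]
  exact (((hu 0).mul (((hv 1).mul (hw 2)).sub ((hv 2).mul (hw 1)))).add
    ((hu 1).mul (((hv 2).mul (hw 0)).sub ((hv 0).mul (hw 2))))).add
    ((hu 2).mul (((hv 0).mul (hw 1)).sub ((hv 1).mul (hw 0))))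

theorem dot3_fderiv_eq_zero_of_norm_eq_one {w : E2 → E3} {U : Set E2} (hU : IsOpen U)
    (hw : ∀ X ∈ U, ‖w X‖ = 1) {X : E2} (hX : X ∈ U) (hd : DifferentiableAt ℝ w X) (e : E2) :
    dot3 (fderiv ℝ w X e) (w X) = 0 := by
  have h1 : (fun Y => ‖w Y‖ ^ 2) =ᶠ[𝓝 X] fun _ => (1 : ℝ) :=
    Filter.eventually_of_mem (hU.mem_nhds hX) fun Y hY => by simp [hw Y hY]
  have h2 := h1.fderiv_eq (𝕜 := ℝ)
  rw [hd.hasFDerivAt.norm_sq.fderiv] at h2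
  have h3 := congrArg (fun L : E2 →L[ℝ] ℝ => L e) h2
  simp only [fderiv_fun_const, Pi.zero_apply, zero_apply] at h3
  simp [PiLp.inner_apply, Fin.sum_univ_three] at h3
  rw [dot3_eq]
  linarith

theorem fderiv_comp_chart {xh : E2 × ℝ → E3} {t : ℝ} (hxh : ContDiff ℝ 2 xh) {Φ : E3 × ℝ → E3}
    (hΦ : ContDiff ℝ 1 Φ) (α : Fin 2) (X : E2) (j : Fin 3) :
    fderiv ℝ (fun Y => Φ (xh (Y, t), t)) X (EuclideanSpace.single α 1) j =
      ∑ i, gVec xh α X t i * pdx i (fun p => Φ p j) (xh (X, t)) t := by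
  have hΦt : DifferentiableAt ℝ (fun y => Φ (y, t)) (xh (X, t)) :=
    (contDiff_slice hΦ t).differentiable (by norm_num) _
  have hf : DifferentiableAt ℝ (fun Y => xh (Y, t)) X :=
    (contDiff_slice hxh t).differentiable (by norm_num) _
  have hpdx (i : Fin 3) : pdx i (fun p => Φ p j) (xh (X, t)) t =
      fderiv ℝ (fun y => Φ (y, t)) (xh (X, t)) (EuclideanSpace.single i 1) j := by
    have h := (((EuclideanSpace.proj j : E3 →L[ℝ] ℝ).hasFDerivAt).comp _ hΦt.hasFDerivAt).fderiv
    rw [pdx, show (fun y => Φ (y, t) j) = (EuclideanSpace.proj j : E3 →L[ℝ] ℝ) ∘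
      fun y => Φ (y, t) from rfl, h]
    simp
  have hcomp : fderiv ℝ (fun Y => Φ (xh (Y, t), t)) X =
      (fderiv ℝ (fun y => Φ (y, t)) (xh (X, t))).comp (fderiv ℝ (fun Y => xh (Y, t)) X) :=
    (HasFDerivAt.comp (g := fun y => Φ (y, t)) X hΦt.hasFDerivAt hf.hasFDerivAt).fderiv
  have hg : fderiv ℝ (fun Y => xh (Y, t)) X (EuclideanSpace.single α 1) =
      ∑ i, gVec xh α X t i • EuclideanSpace.single i (1 : ℝ) := by
    ext k
    fin_cases k <;> simp [Fin.sum_univ_three, gVec]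
  rw [hcomp, ContinuousLinearMap.comp_apply, hg, map_sum]
  simp [hpdx]

/-- In a chart, the Euclidean divergence of the pulled-back flux of a tangential vector field is the
area density times its surface divergence. -/
theorem sum_fderiv_flux_eq {xh : E2 × ℝ → E3} {t : ℝ} (hxh : ContDiff ℝ 2 xh) {N Φ : E3 × ℝ → E3}
    (hN : ContDiff ℝ 1 N) (hΦ : ContDiff ℝ 1 Φ) {U : Set E2} (hU : IsOpen U)
    (hNunit : ∀ X ∈ U, ‖N (xh (X, t), t)‖ = 1) {X : E2} (hX : X ∈ U) (hG : 0 < Gdet xh X t)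
    (hcross : cross3 (gVec xh 0 X t) (gVec xh 1 X t) = √(Gdet xh X t) • N (xh (X, t), t))
    (hΦN : dot3 (Φ (xh (X, t), t)) (N (xh (X, t), t)) = 0) :
    fderiv ℝ (fun Y => dot3 (Φ (xh (Y, t), t)) (cross3 (gVec xh 1 Y t) (N (xh (Y, t), t)))) X
        (EuclideanSpace.single 0 1) +
      fderiv ℝ (fun Y => dot3 (Φ (xh (Y, t), t)) (cross3 (N (xh (Y, t), t)) (gVec xh 0 Y t))) X
        (EuclideanSpace.single 1 1) = √(Gdet xh X t) * sdiv N Φ (xh (X, t)) t := by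
  have hf := (contDiff_slice hxh t).of_le (m := 1) (by norm_num)
  have hdiff {Ψ : E3 × ℝ → E3} (hΨ : ContDiff ℝ 1 Ψ) :
      DifferentiableAt ℝ (fun Y => Ψ (xh (Y, t), t)) X :=
    ((contDiff_slice hΨ t).comp hf).differentiable (by norm_num) X
  have hg (α : Fin 2) : DifferentiableAt ℝ (fun Y => gVec xh α Y t) X :=
    (contDiff_gVec hxh α).differentiable (by norm_num) X
  rw [fderiv_dot3_cross3 (hdiff hΦ) (hg 1) (hdiff hN),
    fderiv_dot3_cross3 (hdiff hΦ) (hdiff hN) (hg 0),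
    fderiv_gVec_comm hxh]
  have hDN (e : E2) := dot3_fderiv_eq_zero_of_norm_eq_one hU hNunit hX (hdiff hN) e
  have hnn : dot3 (N (xh (X, t), t)) (N (xh (X, t), t)) = 1 := by
    rw [← norm_sq_eq_dot3, hNunit X hX, one_pow]
  have hres := mul_cross3_add_mul_cross3 hnn hcross
  have hp0 := fderiv_comp_chart (t := t) hxh hΦ 0 X
  have hp1 := fderiv_comp_chart (t := t) hxh hΦ 1 X
  have hJ : √(Gdet xh X t) ≠ 0 := (Real.sqrt_pos.2 hG).ne'
  have hN_eq (k : Fin 3) :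
      cross3 (gVec xh 0 X t) (gVec xh 1 X t) k = √(Gdet xh X t) * N (xh (X, t), t) k := by
    rw [hcross]; simp
  have hgN (α : Fin 2) : dot3 (gVec xh α X t) (N (xh (X, t), t)) = 0 := by
    refine mul_left_cancel₀ hJ ?_
    have h0 := hN_eq 0
    have h1 := hN_eq 1
    have h2 := hN_eq 2
    simp only [cross3_zero, cross3_one, cross3_two] at h0 h1 h2
    rw [dot3_eq]
    fin_cases α <;> simp only [Fin.zero_eta, Fin.mk_one]
    · linear_combination - gVec xh 0 X t 0 * h0 - gVec xh 0 X t 1 * h1 - gVec xh 0 X t 2 * h2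
    · linear_combination - gVec xh 1 X t 0 * h0 - gVec xh 1 X t 1 * h1 - gVec xh 1 X t 2 * h2
  have hz0 := dot3_cross3_eq_zero_of_orthogonal hnn hΦN (hgN 1) (hDN (EuclideanSpace.single 0 1))
  have hz1 := dot3_cross3_eq_zero_of_orthogonal hnn hΦN (hDN (EuclideanSpace.single 1 1)) (hgN 0)
  rw [hz0, hz1]
  have hsdiv : √(Gdet xh X t) * sdiv N Φ (xh (X, t)) t = ∑ j, ∑ i,
      (gVec xh 0 X t i * cross3 (gVec xh 1 X t) (N (xh (X, t), t)) j +
        gVec xh 1 X t i * cross3 (N (xh (X, t), t)) (gVec xh 0 X t) j) *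
        pdx i (fun p => Φ p j) (xh (X, t)) t := by
    simp only [sdiv, tder, Finset.mul_sum, hres, mul_assoc]
  rw [hsdiv]
  have hanti (p d n : E3) : dot3 p (cross3 d n) + dot3 p (cross3 n d) = 0 := by
    simp only [dot3_eq, cross3_zero, cross3_one, cross3_two]; ring
  have hswap := hanti (Φ (xh (X, t), t)) (fderiv ℝ (fun Y => gVec xh 0 Y t) X
    (EuclideanSpace.single 1 1)) (N (xh (X, t), t))
  have hsum : ∀ c : Fin 3 → Fin 3 → ℝ, ∀ a b u v : Fin 3 → ℝ,
      ∑ j, ∑ i, (a i * u j + b i * v j) * c i j =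
        ∑ j, (∑ i, a i * c i j) * u j + ∑ j, (∑ i, b i * c i j) * v j := by
    intro c a b u v
    simp only [Fin.sum_univ_three]; ring
  have hsum' := hsum (fun i j => pdx i (fun p => Φ p j) (xh (X, t)) t) (fun i => gVec xh 0 X t i)
    (fun i => gVec xh 1 X t i) (fun j => cross3 (gVec xh 1 X t) (N (xh (X, t), t)) j)
    (fun j => cross3 (N (xh (X, t), t)) (gVec xh 0 X t) j)
  simp only [← hp0, ← hp1] at hsum'
  rw [hsum']
  simp only [dot3] at hswap ⊢
  linear_combination hswap

/-- The surface divergence theorem for a tangential field with vanishing co-normal component,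
written in a chart. -/
theorem setIntegral_sqrt_mul_sdiv_eq_zero {xh : E2 × ℝ → E3} {t : ℝ} (hxh : ContDiff ℝ 2 xh)
    {N Φ : E3 × ℝ → E3} (hN : ContDiff ℝ 1 N) (hΦ : ContDiff ℝ 1 Φ) {U : Set E2} (hU : IsOpen U)
    {nU : E2 → E2} (hnU : IsUnitOuterNormal U nU) (hG : ∀ X ∈ closure U, 0 < Gdet xh X t)
    (hNs : ∀ X ∈ closure U, N (xh (X, t), t) = nHat xh X t)
    (hNunit : ∀ X ∈ U, ‖N (xh (X, t), t)‖ = 1)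
    (hΦN : ∀ X ∈ U, dot3 (Φ (xh (X, t), t)) (N (xh (X, t), t)) = 0)
    (hΦν : ∀ᵐ X ∂((μH[1] : Measure E2).restrict (frontier U)),
      dot3 (Φ (xh (X, t), t)) (conormal xh nU X t) = 0) :
    ∫ X in U, √(Gdet xh X t) * sdiv N Φ (xh (X, t)) t = 0 := by
  have hf := (contDiff_slice hxh t).of_le (m := 1) (by norm_num)
  have hcomp {Ψ : E3 × ℝ → E3} (hΨ : ContDiff ℝ 1 Ψ) : ContDiff ℝ 1 fun Y => Ψ (xh (Y, t), t) :=
    (contDiff_slice hΨ t).comp hf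
  set ψ : E2 → E2 := fun Y =>
    !₂[dot3 (Φ (xh (Y, t), t)) (cross3 (gVec xh 1 Y t) (N (xh (Y, t), t))),
      dot3 (Φ (xh (Y, t), t)) (cross3 (N (xh (Y, t), t)) (gVec xh 0 Y t))] with hψ
  have hψC : ContDiff ℝ 1 ψ := by
    rw [contDiff_euclidean]
    intro α
    fin_cases α
    · exact contDiff_dot3_cross3 (hcomp hΦ) (contDiff_gVec hxh 1) (hcomp hN)
    · exact contDiff_dot3_cross3 (hcomp hΦ) (hcomp hN) (contDiff_gVec hxh 0)
  have hGauss := hnU.2 ψ hψC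
  have hbd : ∫ X in frontier U, dot2 (ψ X) (nU X) ∂(μH[1] : Measure E2) = 0 := by
    refine integral_eq_zero_of_ae ?_
    filter_upwards [hΦν, ae_restrict_mem isClosed_frontier.measurableSet] with X hX hXU
    set w := nU X 0 • gVec xh 1 X t - nU X 1 • gVec xh 0 X t with hw
    have hX' : ‖w‖⁻¹ * dot3 (Φ (xh (X, t), t)) (cross3 w (N (xh (X, t), t))) = 0 := by
      rw [conormal, ← hw, ← hNs X (frontier_subset_closure hXU)] at hX
      rw [← hX]
      simp [dot3_eq]
      ring
    have hflux : dot2 (ψ X) (nU X) = dot3 (Φ (xh (X, t), t)) (cross3 w (N (xh (X, t), t))) := by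
      simp [dot2, hψ, hw, dot3_eq, Fin.sum_univ_two]
      ring
    rw [hflux]
    rcases mul_eq_zero.1 hX' with h | h
    · rw [inv_eq_zero, norm_eq_zero] at h
      simp [h, dot3_eq]
    · exact h
  rw [hbd] at hGauss
  rw [← hGauss]
  refine setIntegral_congr_fun hU.measurableSet fun X hX => ?_
  have hXc := subset_closure hX
  have hcross : cross3 (gVec xh 0 X t) (gVec xh 1 X t) = √(Gdet xh X t) • N (xh (X, t), t) := by
    rw [hNs X hXc, cross3_gVec_eq xh (hG X hXc)]
  have := sum_fderiv_flux_eq hxh hN hΦ hU hNunit hX (hG X hXc) hcross (hΦN X hX)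
  rw [Fin.sum_univ_two]
  exact this.symm

/-- The vector field `x_a M_b − x_b M_a` built from two rows of the matrix field `M`. -/
def torqueField (M : E3 × ℝ → Matrix (Fin 3) (Fin 3) ℝ) (a b : Fin 3) (p : E3 × ℝ) : E3 :=
  WithLp.toLp 2 fun j => p.1 a * M p b j - p.1 b * M p a j

section TorqueField

variable {M : E3 × ℝ → Matrix (Fin 3) (Fin 3) ℝ}

@[simp] theorem torqueField_apply (a b : Fin 3) (p : E3 × ℝ) (j : Fin 3) :
    torqueField M a b p j = p.1 a * M p b j - p.1 b * M p a j := rfl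

theorem contDiff_torqueField (hM : ∀ i j, ContDiff ℝ 1 fun p => M p i j) (a b : Fin 3) :
    ContDiff ℝ 1 (torqueField M a b) := by
  rw [contDiff_euclidean]
  intro j
  have hx (c : Fin 3) : ContDiff ℝ 1 fun p : E3 × ℝ => p.1 c :=
    (EuclideanSpace.proj c : E3 →L[ℝ] ℝ).contDiff.comp contDiff_fst
  exact ((hx a).mul (hM b j)).sub ((hx b).mul (hM a j))

theorem dot3_torqueField_eq_zero {p : E3 × ℝ} {w : E3} (h : mulVec3 (M p) w = 0) (a b : Fin 3) :
    dot3 (torqueField M a b p) w = 0 := by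
  have hr (i : Fin 3) : M p i 0 * w 0 + M p i 1 * w 1 + M p i 2 * w 2 = 0 := by
    have := congrArg (fun v : E3 => v i) h
    simpa [mulVec3, Matrix.mulVec, dotProduct, Fin.sum_univ_three] using this
  simp only [dot3_eq, torqueField_apply]
  linear_combination p.1 a * hr b - p.1 b * hr a

theorem pdx_torqueField (hM : ∀ i j, ContDiff ℝ 1 fun p => M p i j) (a b i j : Fin 3) (x : E3)
    (t : ℝ) :
    pdx i (fun p => torqueField M a b p j) x t =
      (if i = a then 1 else 0) * M (x, t) b j + x a * pdx i (fun p => M p b j) x t -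
        ((if i = b then 1 else 0) * M (x, t) a j + x b * pdx i (fun p => M p a j) x t) := by
  have hd (c k : Fin 3) : HasFDerivAt (fun y : E3 => M (y, t) c k) _ x :=
    ((contDiff_slice (hM c k) t).differentiable (by norm_num) x).hasFDerivAt
  have hx (c : Fin 3) : HasFDerivAt (fun y : E3 => y c) (EuclideanSpace.proj c : E3 →L[ℝ] ℝ) x :=
    (EuclideanSpace.proj c : E3 →L[ℝ] ℝ).hasFDerivAt
  have h := (((hx a).mul (hd b j)).sub ((hx b).mul (hd a j))).fderiv
  unfold pdx
  refine (congrArg (fun L : E3 →L[ℝ] ℝ => L (EuclideanSpace.single i 1)) h).trans ?_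
  simp [eq_comm (a := i)]
  ring

/-- For a symmetric matrix field annihilating the normal, the surface divergence of `torqueField`
is a component of the torque density. -/
theorem sdiv_torqueField {N : E3 × ℝ → E3} (hM : ∀ i j, ContDiff ℝ 1 fun p => M p i j) {x : E3}
    {t : ℝ} (hsym : (M (x, t)).IsSymm) (hMn : mulVec3 (M (x, t)) (N (x, t)) = 0) (a b : Fin 3) :
    sdiv N (torqueField M a b) x t = x a * sdivM N M x t b - x b * sdivM N M x t a := by
  have hr (i : Fin 3) : ∑ j, M (x, t) i j * N (x, t) j = 0 := by
    have := congrArg (fun v : E3 => v i) hMn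
    simpa [mulVec3, Matrix.mulVec, dotProduct] using this
  have hpt (j : Fin 3) : tder N j (fun p => torqueField M a b p j) x t =
      x a * tder N j (fun p => M p b j) x t - x b * tder N j (fun p => M p a j) x t +
        (((if a = j then 1 else 0) * M (x, t) b j - (if b = j then 1 else 0) * M (x, t) a j) -
          (N (x, t) a * (M (x, t) b j * N (x, t) j) - N (x, t) b * (M (x, t) a j * N (x, t) j))) := by
    have hsel (c : Fin 3) (y : ℝ) : ∑ i, ((if i = j then (1 : ℝ) else 0) - N (x, t) i * N (x, t) j) *
        ((if i = c then 1 else 0) * y) =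
          (if c = j then 1 else 0) * y - N (x, t) c * (y * N (x, t) j) := by
      simp only [sub_mul, ite_mul, mul_ite, one_mul, zero_mul, mul_zero,
        Finset.sum_ite_eq', Finset.mem_univ, if_true]
      split_ifs <;> simp_all <;> ring
    simp only [tder, pdx_torqueField hM]
    rw [← add_sub_assoc, add_sub_assoc, Finset.mul_sum, Finset.mul_sum]
    have h1 := hsel a (M (x, t) b j)
    have h2 := hsel b (M (x, t) a j)
    simp only [Fin.sum_univ_three] at h1 h2 ⊢
    linear_combination h1 - h2
  have hsdivM (i : Fin 3) : sdivM N M x t i = ∑ j, tder N j (fun p => M p i j) x t := rfl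
  simp only [sdiv, hpt, hsdivM]
  rw [Finset.sum_add_distrib, Finset.sum_sub_distrib, Finset.sum_sub_distrib,
    Finset.sum_sub_distrib, Finset.sum_sub_distrib, ← Finset.mul_sum, ← Finset.mul_sum,
    ← Finset.mul_sum, ← Finset.mul_sum, hr, hr]
  simp [hsym.apply a b]

end TorqueField

theorem continuous_tder {N : E3 × ℝ → E3} (hN : ContDiff ℝ 1 N) {f : E3 × ℝ → ℝ}
    (hf : ContDiff ℝ 1 f) (j : Fin 3) (t : ℝ) : Continuous fun x => tder N j f x t := by
  have hNc (i : Fin 3) : Continuous fun x : E3 => N (x, t) i :=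
    (EuclideanSpace.proj i : E3 →L[ℝ] ℝ).continuous.comp (contDiff_slice hN t).continuous
  have hp (i : Fin 3) : Continuous fun x : E3 => pdx i f x t :=
    ((contDiff_slice hf t).continuous_fderiv (by norm_num)).clm_apply continuous_const
  exact continuous_finsetSum _ fun i _ =>
    (continuous_const.sub ((hNc i).mul (hNc j))).mul (hp i)

theorem continuous_cross3_sdivM {N : E3 × ℝ → E3} (hN : ContDiff ℝ 1 N)
    {M : E3 × ℝ → Matrix (Fin 3) (Fin 3) ℝ} (hM : ∀ i j, ContDiff ℝ 1 fun p => M p i j) (t : ℝ) :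
    Continuous fun x => cross3 x (sdivM N M x t) := by
  have hs (i : Fin 3) : Continuous fun x => sdivM N M x t i :=
    continuous_finsetSum Finset.univ fun j _ => continuous_tder hN (hM i j) j t
  have hx (i : Fin 3) : Continuous fun x : E3 => x i :=
    (EuclideanSpace.proj i : E3 →L[ℝ] ℝ).continuous
  refine (PiLp.continuous_toLp 2 _).comp (continuous_pi fun k => ?_)
  fin_cases k
  · exact ((hx 1).mul (hs 2)).sub ((hx 2).mul (hs 1))
  · exact ((hx 2).mul (hs 0)).sub ((hx 0).mul (hs 2))
  · exact ((hx 0).mul (hs 1)).sub ((hx 1).mul (hs 0))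

/-- for a symmetric matrix field annihilating the normal on `Γ(t)` and the
co-normal (H¹-a.e.) on `∂Γ(t)`, the torque of its surface divergence vanishes:
`∫_{Γ(t)} x × (div_Γ M) dH² = 0`. -/
theorem torque_of_surface_divergence_vanishes
    (T : ℝ) (hT : 0 < T)
    (U : Set E2) (hUopen : IsOpen U) (hUconn : IsConnected U) (hUbd : Bornology.IsBounded U)
    (nU : E2 → E2) (hnU : IsUnitOuterNormal U nU)
    (xh : E2 × ℝ → E3) (hxh : ContDiff ℝ 2 xh)
    (lam : ℝ) (hlam : 0 < lam)
    (hG : ∀ X ∈ closure U, ∀ t ∈ Set.Ico (0 : ℝ) T, lam ≤ Gdet xh X t)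
    (hinj : ∀ t ∈ Set.Ico (0 : ℝ) T, Set.InjOn (fun X => xh (X, t)) (closure U))
    (Γ : ℝ → Set E3) (hΓ : ∀ t, Γ t = (fun X => xh (X, t)) '' U)
    (bΓ : ℝ → Set E3) (hbΓ : ∀ t, bΓ t = (fun X => xh (X, t)) '' frontier U)
    (N : E3 × ℝ → E3) (hN : ContDiff ℝ 1 N)
    (hNs : ∀ X ∈ U, ∀ t ∈ Set.Ico (0 : ℝ) T, N (xh (X, t), t) = nHat xh X t)
    (hNnorm : ∀ t ∈ Set.Ico (0 : ℝ) T, ∀ x ∈ Γ t ∪ bΓ t, ‖N (x, t)‖ = 1)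
    (t : ℝ) (ht : t ∈ Set.Ioo (0 : ℝ) T)
    (M : E3 × ℝ → Matrix (Fin 3) (Fin 3) ℝ)
    (hM : ∀ i j : Fin 3, ContDiff ℝ 1 (fun p => M p i j))
    (hsym : ∀ x : E3, (M (x, t)).IsSymm)
    (hMn : ∀ x ∈ Γ t, mulVec3 (M (x, t)) (N (x, t)) = 0)
    (hMν : ∀ᵐ X ∂((μH[1] : Measure E2).restrict (frontier U)),
      mulVec3 (M (xh (X, t), t)) (conormal xh nU X t) = 0) :
    (∫ x in Γ t, cross3 x (sdivM N M x t) ∂(μH[2] : Measure E3)) = 0 := by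
  have htI : t ∈ Set.Ico (0 : ℝ) T := ⟨ht.1.le, ht.2⟩
  set f : E2 → E3 := fun Y => xh (Y, t) with hf
  have hfC : ContDiff ℝ 1 f := (contDiff_slice hxh t).of_le (by norm_num)
  have hGpos : ∀ X ∈ closure U, 0 < Gdet xh X t := fun X hX => hlam.trans_le (hG X hX t htI)
  have hgram (X : E2) : gramDet (fderiv ℝ f X) = Gdet xh X t := gramDet_fderiv_eq_Gdet xh X t
  have hGc : Continuous fun X => √(Gdet xh X t) := by
    simp only [← hgram]
    exact (continuous_gramDet_fderiv hfC).sqrt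
  have hmem : ∀ X ∈ U, f X ∈ Γ t := fun X hX => by
    rw [hΓ]; exact ⟨X, hX, rfl⟩
  have hNcl : ∀ X ∈ closure U, N (xh (X, t), t) = nHat xh X t := by
    have hNc : Continuous fun X => N (f X, t) :=
      (contDiff_slice hN t).continuous.comp hfC.continuous
    have hg (α : Fin 2) (i : Fin 3) : Continuous fun X => gVec xh α X t i :=
      (EuclideanSpace.proj i : E3 →L[ℝ] ℝ).continuous.comp (contDiff_gVec hxh α).continuous
    have hcr : Continuous fun X => cross3 (gVec xh 0 X t) (gVec xh 1 X t) := by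
      refine (PiLp.continuous_toLp 2 _).comp (continuous_pi fun k => ?_)
      fin_cases k
      · exact ((hg 0 1).mul (hg 1 2)).sub ((hg 0 2).mul (hg 1 1))
      · exact ((hg 0 2).mul (hg 1 0)).sub ((hg 0 0).mul (hg 1 2))
      · exact ((hg 0 0).mul (hg 1 1)).sub ((hg 0 1).mul (hg 1 0))
    have hEq : Set.EqOn (fun X => √(Gdet xh X t) • N (f X, t))
        (fun X => cross3 (gVec xh 0 X t) (gVec xh 1 X t)) (closure U) := by
      refine Set.EqOn.closure (fun X hX => ?_) (hGc.smul hNc) hcr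
      have hX' := cross3_gVec_eq xh (hGpos X (subset_closure hX))
      rw [← hNs X hX t htI] at hX'
      exact hX'.symm
    intro X hX
    have hX' := hEq hX
    simp only [cross3_gVec_eq xh (hGpos X hX)] at hX'
    exact smul_right_injective E3 (Real.sqrt_pos.2 (hGpos X hX)).ne' hX'
  have hzero (a b : Fin 3) : ∫ X in U, √(Gdet xh X t) *
      (f X a * sdivM N M (f X) t b - f X b * sdivM N M (f X) t a) = 0 := by
    rw [← setIntegral_sqrt_mul_sdiv_eq_zero hxh hN (contDiff_torqueField hM a b) hUopen hnU hGpos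
      hNcl (fun X hX => hNnorm t htI _ (Or.inl (hmem X hX)))
      (fun X hX => dot3_torqueField_eq_zero (hMn _ (hmem X hX)) a b)
      (hMν.mono fun X hX => dot3_torqueField_eq_zero hX a b)]
    refine setIntegral_congr_fun hUopen.measurableSet fun X hX => ?_
    exact congrArg _ (sdiv_torqueField hM (hsym _) (hMn _ (hmem X hX)) a b).symm
  have hh := continuous_cross3_sdivM hN hM t
  rw [hΓ, setIntegral_image_eq_setIntegral_sqrt_gramDet_smul hfC hUopen
    ((hinj t htI).mono subset_closure)
    (fun X hX => by rw [hgram]; exact hGpos X (subset_closure hX)) hh,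
    Measure.isAddLeftInvariant_eq_smul (μH[2] : Measure E2) volume, Measure.restrict_smul,
    integral_smul_nnreal_measure]
  simp only [hgram]
  have hint : IntegrableOn (fun X => √(Gdet xh X t) • cross3 (f X) (sdivM N M (f X) t)) U :=
    ((hGc.smul (hh.comp hfC.continuous)).continuousOn.integrableOn_compact
      hUbd.isCompact_closure).mono_set subset_closure
  have hI : ∫ X in U, √(Gdet xh X t) • cross3 (f X) (sdivM N M (f X) t) = 0 := by
    ext k
    refine ((EuclideanSpace.proj k : E3 →L[ℝ] ℝ).integral_comp_comm hint).symm.trans ?_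
    fin_cases k
    · exact hzero 1 2
    · exact hzero 2 0
    · exact hzero 0 1
  rw [hI, smul_zero]
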